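/- Let S be a pseudogroup. The following are equivalent: (1) S is 0-simplifying (its only sup-ideals are {0} and S); (2) the equivalence relation ≡ induced by the preorder ⪯ is the universal relation on the set of non-zero idempotents of S (i.e. e ⪯ f and f ⪯ e for all non-zero e, f ∈ E(S)); (3) for any two non-zero idempotents e and f there is a subset Z ⊆ S such that e = ⋁_{z∈Z} d(z) and f = ⋁_{z∈Z} r(z). -/

import Mathlib

namespace PseudogroupMorita

/-- An inverse semigroup: a semigroup in which every element `a` has a unique
inverse `a⁻¹` satisfying `a * a⁻¹ * a = a` and `a⁻¹ * a * a⁻¹ = a⁻¹`. -/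
class InverseSemigroup (S : Type*) extends Semigroup S, Inv S where
  mul_inv_mul : ∀ a : S, a * a⁻¹ * a = a
  inv_mul_inv : ∀ a : S, a⁻¹ * a * a⁻¹ = a⁻¹
  inv_unique : ∀ a b : S, a * b * a = a → b * a * b = b → b = a⁻¹

/-- `a` is an idempotent. -/
def IsIdem {S : Type*} [Mul S] (a : S) : Prop := a * a = a

/-- The natural partial order: `a ≤ b` iff `a = e * b` for some idempotent `e`. -/
def nle {S : Type*} [Mul S] (a b : S) : Prop := ∃ e : S, IsIdem e ∧ a = e * b

/-- `s` and `t` are left compatible: `s⁻¹ * t` is an idempotent. -/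
def LeftCompat {S : Type*} [Mul S] [Inv S] (s t : S) : Prop := IsIdem (s⁻¹ * t)

/-- `s` and `t` are right compatible: `s * t⁻¹` is an idempotent. -/
def RightCompat {S : Type*} [Mul S] [Inv S] (s t : S) : Prop := IsIdem (s * t⁻¹)

/-- `s` and `t` are compatible. -/
def Compat {S : Type*} [Mul S] [Inv S] (s t : S) : Prop := LeftCompat s t ∧ RightCompat s t

/-- A compatible subset: any two of its elements are compatible. -/
def CompatSet {S : Type*} [Mul S] [Inv S] (A : Set S) : Prop := ∀ a ∈ A, ∀ b ∈ A, Compat a b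

/-- `j` is the join (least upper bound) of `A` with respect to the natural partial order. -/
def IsJoin {S : Type*} [Mul S] (A : Set S) (j : S) : Prop :=
  (∀ a ∈ A, nle a j) ∧ ∀ b : S, (∀ a ∈ A, nle a b) → nle j b

/-- A pseudogroup: an inverse semigroup in which every compatible subset has a join
and multiplication distributes over such joins. -/
class Pseudogroup (S : Type*) extends InverseSemigroup S where
  joins_exist : ∀ A : Set S, CompatSet A → ∃ j : S, IsJoin A j
  mul_join_left : ∀ (s : S) (A : Set S) (j : S), CompatSet A → IsJoin A j →
    IsJoin ((fun a => s * a) '' A) (s * j)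
  mul_join_right : ∀ (s : S) (A : Set S) (j : S), CompatSet A → IsJoin A j →
    IsJoin ((fun a => a * s) '' A) (j * s)

/-- `A^∨`: the set of all joins of compatible subsets of `A`. -/
def supClosure {S : Type*} [Mul S] [Inv S] (A : Set S) : Set S :=
  {j | ∃ C : Set S, C ⊆ A ∧ CompatSet C ∧ IsJoin C j}

/-- The underlying set of the local semigroup `eSe`. -/
def locSet {S : Type*} [Mul S] (e : S) : Set S := {u : S | u = e * u * e}

/-- The set `A * B * C` of triple products. -/
def tripleProd {S : Type*} [Mul S] (A B C : Set S) : Set S :=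
  {x : S | ∃ a ∈ A, ∃ b ∈ B, ∃ c ∈ C, x = a * b * c}

/-- A (two-sided) semigroup ideal. -/
def SemigroupIdeal {S : Type*} [Mul S] (I : Set S) : Prop :=
  ∀ s : S, ∀ a ∈ I, s * a ∈ I ∧ a * s ∈ I

/-- A sup-ideal: an ideal closed under arbitrary compatible joins. -/
def IsSupIdeal {S : Type*} [Mul S] [Inv S] (I : Set S) : Prop :=
  SemigroupIdeal I ∧ ∀ C : Set S, C ⊆ I → CompatSet C → ∀ j : S, IsJoin C j → j ∈ I

/-- A pencil from `e` to `f`: a subset `X` with `e = ⋁_{x ∈ X} d x` and `f ≥ ⋁_{x ∈ X} r x`. -/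
def IsPencil {S : Type*} [Mul S] [Inv S] (X : Set S) (e f : S) : Prop :=
  IsJoin ((fun x => x⁻¹ * x) '' X) e ∧
  ∃ j : S, IsJoin ((fun x => x * x⁻¹) '' X) j ∧ nle j f

/-- `e ⪯ f` iff there is a pencil from `e` to `f`. -/
def PencilLE {S : Type*} [Mul S] [Inv S] (e f : S) : Prop := ∃ X : Set S, IsPencil X e f

/-- A sup-ideal of the (local) pseudogroup whose underlying set is `A`. -/
def IsSupIdealIn {S : Type*} [Mul S] [Inv S] (A I : Set S) : Prop :=
  I ⊆ A ∧ (∀ s ∈ A, ∀ a ∈ I, s * a ∈ I ∧ a * s ∈ I) ∧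
  ∀ C : Set S, C ⊆ I → CompatSet C → ∀ j : S, IsJoin C j → j ∈ I

/-- The (local) pseudogroup with underlying set `A` and least element `z` is 0-simplifying:
its only sup-ideals are `{z}` and `A` itself. -/
def ZeroSimplifyingIn {S : Type*} [Mul S] [Inv S] (A : Set S) (z : S) : Prop :=
  ∀ I : Set S, IsSupIdealIn A I → I = {z} ∨ I = A

/-- The (local) inverse semigroup with underlying set `A` is fundamental: any of its
elements commuting with all of its idempotents is an idempotent. -/
def FundamentalIn {S : Type*} [Mul S] (A : Set S) : Prop :=
  ∀ a ∈ A, (∀ g ∈ A, IsIdem g → a * g = g * a) → IsIdem a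

/-- A supported left action of an inverse semigroup `S` on a set `X`. -/
structure SupportedAction (S : Type*) [InverseSemigroup S] (X : Type*) where
  act : S → X → X
  act_mul : ∀ (s t : S) (x : X), act (s * t) x = act s (act t x)
  p : X → S
  p_idem : ∀ x : X, IsIdem (p x)
  p_act : ∀ x : X, act (p x) x = x
  p_conj : ∀ (s : S) (x : X), p (act s x) = s * p x * s⁻¹

namespace SupportedAction

variable {S : Type*} [InverseSemigroup S] {X Y : Type*}

/-- `x` and `y` are left compatible: `p(x) y = p(y) x`. -/
def LCompat (M : SupportedAction S X) (x y : X) : Prop :=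
  M.act (M.p x) y = M.act (M.p y) x

/-- A left compatible subset of `X`. -/
def LCompatSet (M : SupportedAction S X) (A : Set X) : Prop :=
  ∀ x ∈ A, ∀ y ∈ A, M.LCompat x y

/-- The order on `X`: `x ≤ y` iff `x = e • y` for some idempotent `e`. -/
def xle (M : SupportedAction S X) (x y : X) : Prop :=
  ∃ e : S, IsIdem e ∧ x = M.act e y

/-- `j` is the join of `A ⊆ X`. -/
def IsJoinX (M : SupportedAction S X) (A : Set X) (j : X) : Prop :=
  (∀ a ∈ A, M.xle a j) ∧ ∀ b : X, (∀ a ∈ A, M.xle a b) → M.xle j b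

/-- `m` is the (binary) meet of `x` and `y` in `X`. -/
def IsMeetX (M : SupportedAction S X) (x y m : X) : Prop :=
  M.xle m x ∧ M.xle m y ∧ ∀ z : X, M.xle z x → M.xle z y → M.xle z m

/-- The action is pointed, with minimum `z ∈ X` and `zS` the least element of `S`:
`s • z = z` and `zS • x = z`. -/
def Pointed (M : SupportedAction S X) (z : X) (zS : S) : Prop :=
  (∀ x : X, M.xle z x) ∧ (∀ s : S, M.act s z = z) ∧ (∀ x : X, M.act zS x = z)

/-- A homomorphism of supported left `S`-actions. -/
def IsActHom (M : SupportedAction S X) (N : SupportedAction S Y) (θ : X → Y) : Prop :=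
  (∀ (s : S) (x : X), θ (M.act s x) = N.act s (θ x)) ∧ ∀ x : X, N.p (θ x) = M.p x

end SupportedAction

/-- A left `S`-module over a pseudogroup `S`: a supported left action such that every
left compatible subset of `X` has a join, the action distributes over left compatible
joins, and joins of compatible subsets of `S` act as joins. -/
structure SMod (S : Type*) [Pseudogroup S] (X : Type*) extends SupportedAction S X where
  joinsX : ∀ A : Set X, toSupportedAction.LCompatSet A → ∃ j : X, toSupportedAction.IsJoinX A j
  act_joinX : ∀ (s : S) (A : Set X) (j : X), toSupportedAction.LCompatSet A →
    toSupportedAction.IsJoinX A j →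
    toSupportedAction.IsJoinX (toSupportedAction.act s '' A) (toSupportedAction.act s j)
  join_act : ∀ (A : Set S) (j : S), CompatSet A → IsJoin A j → ∀ x : X,
    toSupportedAction.IsJoinX ((fun s => toSupportedAction.act s x) '' A)
      (toSupportedAction.act j x)

/-- A homomorphism of left `S`-modules: a homomorphism of the underlying supported
actions preserving all left compatible joins. -/
def IsModHom {S X Y : Type*} [Pseudogroup S] (M : SMod S X) (N : SMod S Y) (θ : X → Y) : Prop :=
  SupportedAction.IsActHom M.toSupportedAction N.toSupportedAction θ ∧
  ∀ (A : Set X) (j : X), M.toSupportedAction.LCompatSet A → M.toSupportedAction.IsJoinX A j →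
    N.toSupportedAction.IsJoinX (θ '' A) (θ j)

/-- `L(X)`: the set of left compatible order-ideals of a supported action `X`. -/
abbrev LIdeal {S : Type*} [InverseSemigroup S] {X : Type*} (M : SupportedAction S X) : Type _ :=
  {A : Set X // (∀ x y : X, M.xle x y → y ∈ A → x ∈ A) ∧ M.LCompatSet A}

/-- An `(S,T)`-biaction with inner products. -/
structure Biaction (S T : Type*) [InverseSemigroup S] [InverseSemigroup T] (X : Type*) where
  actL : S → X → X
  actL_mul : ∀ (s t : S) (x : X), actL (s * t) x = actL s (actL t x)
  actR : X → T → X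
  actR_mul : ∀ (x : X) (t u : T), actR x (t * u) = actR (actR x t) u
  actLR : ∀ (s : S) (x : X) (t : T), actR (actL s x) t = actL s (actR x t)
  ip : X → X → S
  iq : X → X → T
  ip_actL : ∀ (s : S) (x y : X), ip (actL s x) y = s * ip x y
  ip_symm : ∀ x y : X, ip y x = (ip x y)⁻¹
  ip_self_act : ∀ x : X, actL (ip x x) x = x
  iq_actR : ∀ (x y : X) (t : T), iq x (actR y t) = iq x y * t
  iq_symm : ∀ x y : X, iq y x = (iq x y)⁻¹
  iq_self_act : ∀ x : X, actR x (iq x x) = x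
  ip_iq_assoc : ∀ x y z : X, actL (ip x y) z = actR x (iq y z)

namespace Biaction

variable {S T : Type*} [InverseSemigroup S] [InverseSemigroup T] {X : Type*}

/-- Left compatibility in a biaction: `p(x) y = p(y) x` with `p x = ⟨x,x⟩`. -/
def LCompatX (B : Biaction S T X) (x y : X) : Prop :=
  B.actL (B.ip x x) y = B.actL (B.ip y y) x

/-- Right compatibility in a biaction: `x q(y) = y q(x)` with `q x = [x,x]`. -/
def RCompatX (B : Biaction S T X) (x y : X) : Prop :=
  B.actR x (B.iq y y) = B.actR y (B.iq x x)

/-- Compatibility in a biaction. -/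
def CompatX (B : Biaction S T X) (x y : X) : Prop := B.LCompatX x y ∧ B.RCompatX x y

/-- A compatible subset of `X`. -/
def CompatSetX (B : Biaction S T X) (A : Set X) : Prop := ∀ x ∈ A, ∀ y ∈ A, B.CompatX x y

/-- The order on `X`: `x ≤ y` iff `x = e • y` for some idempotent `e ∈ S`. -/
def bxle (B : Biaction S T X) (x y : X) : Prop := ∃ e : S, IsIdem e ∧ x = B.actL e y

/-- `j` is the join of `A ⊆ X`. -/
def IsJoinBX (B : Biaction S T X) (A : Set X) (j : X) : Prop :=
  (∀ a ∈ A, B.bxle a j) ∧ ∀ b : X, (∀ a ∈ A, B.bxle a b) → B.bxle j b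

end Biaction

/-- An `(S,T)`-bimodule over pseudogroups `S` and `T`. -/
structure Bimodule (S T : Type*) [Pseudogroup S] [Pseudogroup T] (X : Type*) extends
    Biaction S T X where
  joinsX : ∀ A : Set X, toBiaction.CompatSetX A → ∃ j : X, toBiaction.IsJoinBX A j
  distL : ∀ (s : S) (A : Set X) (j : X), toBiaction.CompatSetX A → toBiaction.IsJoinBX A j →
    toBiaction.IsJoinBX (toBiaction.actL s '' A) (toBiaction.actL s j)
  distSL : ∀ (A : Set S) (j : S), CompatSet A → IsJoin A j → ∀ x : X,
    toBiaction.IsJoinBX ((fun s => toBiaction.actL s x) '' A) (toBiaction.actL j x)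
  distR : ∀ (t : T) (A : Set X) (j : X), toBiaction.CompatSetX A → toBiaction.IsJoinBX A j →
    toBiaction.IsJoinBX ((fun x => toBiaction.actR x t) '' A) (toBiaction.actR j t)
  distTR : ∀ (A : Set T) (j : T), CompatSet A → IsJoin A j → ∀ x : X,
    toBiaction.IsJoinBX ((fun t => toBiaction.actR x t) '' A) (toBiaction.actR x j)
  distIP : ∀ (A : Set X) (j : X), toBiaction.CompatSetX A → toBiaction.IsJoinBX A j → ∀ y : X,
    IsJoin ((fun x => toBiaction.ip x y) '' A) (toBiaction.ip j y)
  distIQ : ∀ (A : Set X) (j : X), toBiaction.CompatSetX A → toBiaction.IsJoinBX A j → ∀ y : X,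
    IsJoin ((fun x => toBiaction.iq y x) '' A) (toBiaction.iq y j)

/-- An `(S,T)`-equivalence bimodule: an `(S,T)`-bimodule satisfying both covering
conditions `⋁_{x∈X} ⟨x,x⟩ = e_S` and `⋁_{x∈X} [x,x] = e_T`
(where `e_S = ⋁ E(S)` and `e_T = ⋁ E(T)`). -/
structure EquivBimodule (S T : Type*) [Pseudogroup S] [Pseudogroup T] (X : Type*) extends
    Bimodule S T X where
  coverS : ∀ jS : S, IsJoin {e : S | IsIdem e} jS →
    IsJoin (Set.range fun x : X => toBimodule.toBiaction.ip x x) jS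
  coverT : ∀ jT : T, IsJoin {e : T | IsIdem e} jT →
    IsJoin (Set.range fun x : X => toBimodule.toBiaction.iq x x) jT


section Helpers

variable {S : Type*}

theorem idem_inv [InverseSemigroup S] {e : S} (he : IsIdem e) : e⁻¹ = e := by
  have he' : e * e = e := he
  exact (InverseSemigroup.inv_unique e e (by rw [he', he']) (by rw [he', he'])).symm

theorem h_inv_inv [InverseSemigroup S] (a : S) : a⁻¹⁻¹ = a :=
  (InverseSemigroup.inv_unique a⁻¹ a (InverseSemigroup.inv_mul_inv a)
    (InverseSemigroup.mul_inv_mul a)).symm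

theorem idem_mul [InverseSemigroup S] {e f : S} (he : IsIdem e) (hf : IsIdem f) :
    IsIdem (e * f) := by
  have he' : e * e = e := he
  have hf' : f * f = f := hf
  have h1 := InverseSemigroup.mul_inv_mul (e * f)
  have h2 := InverseSemigroup.inv_mul_inv (e * f)
  have h3 := InverseSemigroup.inv_unique (e * f) (f * (e * f)⁻¹ * e)
  have h4 := h_inv_inv (e * f)
  generalize (e * f)⁻¹ = x at *
  have hx : f * x * e = x := by
    apply h3
    · calc e * f * (f * x * e) * (e * f) = e * (f * f) * x * (e * e) * f := by
            simp only [mul_assoc]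
        _ = e * f * x * (e * f) := by rw [he', hf']; simp only [mul_assoc]
        _ = _ := h1
    · calc f * x * e * (e * f) * (f * x * e) = f * x * (e * e) * (f * f) * x * e := by
            simp only [mul_assoc]
        _ = f * (x * (e * f) * x) * e := by rw [he', hf']; simp only [mul_assoc]
        _ = _ := by rw [h2]
  have hxi : IsIdem x := by
    show x * x = x
    calc x * x = (f * x * e) * (f * x * e) := by rw [hx]
      _ = f * (x * (e * f) * x) * e := by simp only [mul_assoc]
      _ = x := by rw [h2, hx]
  rw [← h4, idem_inv hxi]
  exact hxi

theorem idem_comm [InverseSemigroup S] {e f : S} (he : IsIdem e) (hf : IsIdem f) :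
    e * f = f * e := by
  have he' : e * e = e := he
  have hf' : f * f = f := hf
  have h1 : e * f * (e * f) = e * f := idem_mul he hf
  have h2 : f * e * (f * e) = f * e := idem_mul hf he
  have := InverseSemigroup.inv_unique (e * f) (f * e)
    (by calc e * f * (f * e) * (e * f) = e * (f * f) * (e * e) * f := by simp only [mul_assoc]
          _ = e * f * (e * f) := by rw [he', hf']; simp only [mul_assoc]
          _ = _ := h1)
    (by calc f * e * (e * f) * (f * e) = f * (e * e) * (f * f) * e := by simp only [mul_assoc]
          _ = f * e * (f * e) := by rw [he', hf']; simp only [mul_assoc]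
          _ = _ := h2)
  rw [this, idem_inv (idem_mul he hf)]

theorem idem_d [InverseSemigroup S] (a : S) : IsIdem (a⁻¹ * a) := by
  show a⁻¹ * a * (a⁻¹ * a) = a⁻¹ * a
  rw [← mul_assoc, InverseSemigroup.inv_mul_inv]

theorem idem_r [InverseSemigroup S] (a : S) : IsIdem (a * a⁻¹) := by
  show a * a⁻¹ * (a * a⁻¹) = a * a⁻¹
  rw [← mul_assoc, InverseSemigroup.mul_inv_mul]

theorem h_mul_inv [InverseSemigroup S] (a b : S) : (a * b)⁻¹ = b⁻¹ * a⁻¹ := by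
  have hc := idem_comm (idem_d a) (idem_r b)
  have h1 := InverseSemigroup.mul_inv_mul a
  have h2 := InverseSemigroup.mul_inv_mul b
  have h3 := InverseSemigroup.inv_mul_inv a
  have h4 := InverseSemigroup.inv_mul_inv b
  symm
  apply InverseSemigroup.inv_unique
  · calc a * b * (b⁻¹ * a⁻¹) * (a * b) = a * ((b * b⁻¹) * (a⁻¹ * a)) * b := by
          simp only [mul_assoc]
      _ = (a * a⁻¹ * a) * (b * b⁻¹ * b) := by rw [← hc]; simp only [mul_assoc]
      _ = _ := by rw [h1, h2]
  · calc b⁻¹ * a⁻¹ * (a * b) * (b⁻¹ * a⁻¹) = b⁻¹ * ((a⁻¹ * a) * (b * b⁻¹)) * a⁻¹ := by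
          simp only [mul_assoc]
      _ = (b⁻¹ * b * b⁻¹) * (a⁻¹ * a * a⁻¹) := by rw [hc]; simp only [mul_assoc]
      _ = _ := by rw [h3, h4]

theorem nle_refl [InverseSemigroup S] (a : S) : nle a a :=
  ⟨a * a⁻¹, idem_r a, (InverseSemigroup.mul_inv_mul a).symm⟩

theorem nle_trans [InverseSemigroup S] {a b c : S} (h : nle a b) (h' : nle b c) : nle a c := by
  obtain ⟨e, he, rfl⟩ := h
  obtain ⟨f, hf, rfl⟩ := h'
  exact ⟨e * f, idem_mul he hf, (mul_assoc _ _ _).symm⟩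

theorem nle_antisymm [InverseSemigroup S] {a b : S} (h : nle a b) (h' : nle b a) : a = b := by
  obtain ⟨e, he, h1⟩ := h
  obtain ⟨f, hf, h2⟩ := h'
  have he' : e * e = e := he
  have hf' : f * f = f := hf
  have h3 : f * b = b := by rw [h2, ← mul_assoc, hf']
  have h4 : e * a = a := by rw [h1, ← mul_assoc, he']
  calc a = e * b := h1
    _ = e * (f * a) := by rw [← h2]
    _ = f * (e * a) := by rw [← mul_assoc, idem_comm he hf, mul_assoc]
    _ = b := by rw [h4, ← h2]

theorem join_unique [InverseSemigroup S] {A : Set S} {j k : S} (h : IsJoin A j)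
    (h' : IsJoin A k) : j = k :=
  nle_antisymm (h.2 _ h'.1) (h'.2 _ h.1)

theorem nle_mul_idem [InverseSemigroup S] {a f : S} (hf : IsIdem f) (h : nle a f) :
    a * f = a := by
  obtain ⟨g, -, rfl⟩ := h
  rw [mul_assoc, show f * f = f from hf]

theorem idem_of_nle [InverseSemigroup S] {a f : S} (hf : IsIdem f) (h : nle a f) :
    IsIdem a := by
  obtain ⟨g, hg, rfl⟩ := h
  exact idem_mul hg hf

theorem compat_idem [InverseSemigroup S] {A : Set S} (h : ∀ a ∈ A, IsIdem a) :
    CompatSet A := by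
  intro a ha b hb
  refine ⟨?_, ?_⟩
  · show IsIdem (a⁻¹ * b)
    rw [idem_inv (h a ha)]; exact idem_mul (h a ha) (h b hb)
  · show IsIdem (a * b⁻¹)
    rw [idem_inv (h b hb)]; exact idem_mul (h a ha) (h b hb)

theorem idem_conj [InverseSemigroup S] {g : S} (hg : IsIdem g) (t : S) :
    IsIdem (t⁻¹ * g * t) := by
  have := idem_d (g * t)
  rw [h_mul_inv, idem_inv hg] at this
  rwa [show t⁻¹ * g * (g * t) = t⁻¹ * (g * g) * t by simp only [mul_assoc],
    show g * g = g from hg] at this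

theorem idem_join [InverseSemigroup S] {A : Set S} (h : ∀ a ∈ A, IsIdem a) {j : S}
    (hj : IsJoin A j) : IsIdem j := by
  refine idem_of_nle (idem_d j) (hj.2 _ ?_)
  intro d hd
  obtain ⟨g, hg, hgd⟩ := hj.1 d hd
  refine ⟨j⁻¹ * g * j, idem_conj hg j, ?_⟩
  have hdd : d⁻¹ * d = d := by rw [idem_inv (h d hd)]; exact h d hd
  calc d = d⁻¹ * d := hdd.symm
    _ = j⁻¹ * (g * g) * j := by rw [hgd, h_mul_inv, idem_inv hg]; simp only [mul_assoc]
    _ = j⁻¹ * g * (j * j⁻¹ * j) := by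
      rw [InverseSemigroup.mul_inv_mul, show g * g = g from hg]
    _ = _ := by simp only [mul_assoc]

theorem mul_zero_join [Pseudogroup S] {z : S} (hz : IsJoin (∅ : Set S) z) (a : S) :
    a * z = z := by
  have := Pseudogroup.mul_join_left a ∅ z (fun _ h => h.elim) hz
  rw [Set.image_empty] at this
  exact join_unique this hz

/-- (1) implies (2). -/
theorem pencil_of_simplifying [Pseudogroup S] (z : S)
    (H : ∀ I : Set S, IsSupIdeal I → I = {z} ∨ I = Set.univ) (e f : S)
    (he : IsIdem e) (hf : IsIdem f) (hfz : f ≠ z) : PencilLE e f := by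
  have he' : e * e = e := he
  have hf' : f * f = f := hf
  let X : Set S := {x | f * x = x}
  let D : Set S := (fun x => x⁻¹ * x) '' X
  have hD : ∀ d ∈ D, IsIdem d := by rintro _ ⟨x, -, rfl⟩; exact idem_d x
  obtain ⟨J, hJ⟩ := Pseudogroup.joins_exist D (compat_idem hD)
  have hJi : IsIdem J := idem_join hD hJ
  have hDJ : ∀ d ∈ D, d * J = d := fun d hd => nle_mul_idem hJi (hJ.1 d hd)
  have hcent : ∀ t : S, J * t * J = J * t := by
    intro t
    have h1 := Pseudogroup.mul_join_right t D J (compat_idem hD) hJ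
    have h2 := Pseudogroup.mul_join_right (t * J) D J (compat_idem hD) hJ
    have h3 : (fun a => a * (t * J)) '' D = (fun a => a * t) '' D := by
      apply Set.image_congr
      rintro _ ⟨x, hx, rfl⟩
      have hx' : f * x = x := hx
      have hmem : (x * t)⁻¹ * (x * t) ∈ D :=
        ⟨x * t, by show f * (x * t) = x * t; rw [← mul_assoc, hx'], rfl⟩
      have h5 := hDJ _ hmem
      calc x⁻¹ * x * (t * J) = x⁻¹ * ((x * t) * (x * t)⁻¹ * (x * t)) * J := by
            rw [InverseSemigroup.mul_inv_mul]; simp only [mul_assoc]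
        _ = x⁻¹ * (x * t) * ((x * t)⁻¹ * (x * t) * J) := by simp only [mul_assoc]
        _ = x⁻¹ * ((x * t) * (x * t)⁻¹ * (x * t)) := by rw [h5]; simp only [mul_assoc]
        _ = x⁻¹ * x * t := by rw [InverseSemigroup.mul_inv_mul]; simp only [mul_assoc]
    rw [h3] at h2
    rw [mul_assoc]
    exact join_unique h2 h1
  have hI : IsSupIdeal {s : S | s * J = s} := by
    refine ⟨fun s a ha => ⟨?_, ?_⟩, ?_⟩
    · show s * a * J = s * a
      rw [mul_assoc, show a * J = a from ha]
    · show a * s * J = a * s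
      have ha' : a * J = a := ha
      calc a * s * J = a * J * s * J := by rw [ha']
        _ = a * (J * s * J) := by simp only [mul_assoc]
        _ = a * J * s := by rw [hcent]; simp only [mul_assoc]
        _ = a * s := by rw [ha']
    · intro C hC hcomp j hj
      have h1 := Pseudogroup.mul_join_right J C j hcomp hj
      have h2 : (fun a => a * J) '' C = C := by
        conv_rhs => rw [← Set.image_id C]
        exact Set.image_congr (fun c hc => hC hc)
      rw [h2] at h1
      exact join_unique h1 hj
  have hfI : f ∈ {s : S | s * J = s} :=
    hDJ f ⟨f, hf', by show f⁻¹ * f = f; rw [idem_inv hf, hf']⟩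
  have heJ : e * J = e := by
    rcases H _ hI with h | h
    · rw [h] at hfI; exact absurd hfI hfz
    · have : e ∈ {s : S | s * J = s} := by rw [h]; trivial
      exact this
  have hr : ∀ a ∈ (fun x : S => x * x⁻¹) '' ((fun x => x * e) '' X), IsIdem a := by
    rintro _ ⟨x, -, rfl⟩; exact idem_r x
  obtain ⟨k, hk⟩ := Pseudogroup.joins_exist _ (compat_idem hr)
  refine ⟨(fun x => x * e) '' X, ?_, k, hk, hk.2 f ?_⟩
  · have h1 := Pseudogroup.mul_join_left e D J (compat_idem hD) hJ
    rw [heJ] at h1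
    convert h1 using 1
    show (fun x : S => x⁻¹ * x) '' ((fun x => x * e) '' X) =
      (fun a => e * a) '' ((fun x => x⁻¹ * x) '' X)
    rw [Set.image_image, Set.image_image]
    apply Set.image_congr
    intro x _
    show (x * e)⁻¹ * (x * e) = e * (x⁻¹ * x)
    rw [h_mul_inv, idem_inv he]
    calc e * x⁻¹ * (x * e) = e * ((x⁻¹ * x) * e) := by simp only [mul_assoc]
      _ = e * e * (x⁻¹ * x) := by rw [idem_comm (idem_d x) he]; simp only [mul_assoc]
      _ = _ := by rw [he']
  · rintro _ ⟨_, ⟨x, hx, rfl⟩, rfl⟩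
    have hx' : f * x = x := hx
    refine ⟨x * e * (x * e)⁻¹, idem_r _, ?_⟩
    rw [idem_comm (idem_r _) hf]
    show x * e * (x * e)⁻¹ = f * (x * e * (x * e)⁻¹)
    simp only [← mul_assoc]
    rw [hx']

/-- (2) implies (1). -/
theorem simplifying_of_pencil [Pseudogroup S] (z : S) (hz : IsJoin (∅ : Set S) z)
    (H : ∀ e f : S, IsIdem e → e ≠ z → IsIdem f → f ≠ z → PencilLE e f)
    (I : Set S) (hI : IsSupIdeal I) : I = {z} ∨ I = Set.univ := by
  have hzI : z ∈ I := hI.2 ∅ (Set.empty_subset _) (fun _ h => h.elim) z hz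
  have key : ∀ s : S, s⁻¹ * s = z → s = z := by
    intro s hs
    calc s = s * (s⁻¹ * s) := by rw [← mul_assoc, InverseSemigroup.mul_inv_mul]
      _ = z := by rw [hs, mul_zero_join hz]
  by_cases h : ∃ a ∈ I, a ≠ z
  · right
    obtain ⟨a, haI, haz⟩ := h
    have hfI : a⁻¹ * a ∈ I := (hI.1 _ _ haI).1
    ext s
    refine ⟨fun _ => trivial, fun _ => ?_⟩
    by_cases hs : s = z
    · rw [hs]; exact hzI
    obtain ⟨X, hX, j, hj, hjf⟩ := H (s⁻¹ * s) (a⁻¹ * a) (idem_d s) (fun h => hs (key s h))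
      (idem_d a) (fun h => haz (key a h))
    have he : s⁻¹ * s ∈ I := by
      refine hI.2 _ ?_ (compat_idem ?_) _ hX
      · rintro _ ⟨x, hx, rfl⟩
        obtain ⟨g, -, hg⟩ := nle_trans (hj.1 _ ⟨x, hx, rfl⟩) hjf
        have h1 : x * x⁻¹ ∈ I := by
          have := (hI.1 g _ hfI).1
          rw [← hg] at this; exact this
        have h2 := (hI.1 x _ h1).2
        rw [InverseSemigroup.mul_inv_mul] at h2
        exact (hI.1 _ _ h2).1
      · rintro _ ⟨x, -, rfl⟩; exact idem_d x
    have := (hI.1 s _ he).1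
    rwa [← mul_assoc, InverseSemigroup.mul_inv_mul] at this
  · left
    push Not at h
    ext s
    exact ⟨fun hs => h s hs, fun hs => by rw [show s = z from hs]; exact hzI⟩

/-- (2) implies (3). -/
theorem join_of_pencils [Pseudogroup S] {e f : S} (h1 : PencilLE e f) (h2 : PencilLE f e) :
    ∃ Z : Set S, IsJoin ((fun a => a⁻¹ * a) '' Z) e ∧ IsJoin ((fun a => a * a⁻¹) '' Z) f := by
  obtain ⟨X, hX, j, hj, hjf⟩ := h1
  obtain ⟨Y, hY, k, hk, hke⟩ := h2
  refine ⟨X ∪ (fun y => y⁻¹) '' Y, ⟨?_, ?_⟩, ⟨?_, ?_⟩⟩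
  · rintro _ ⟨x, hx | ⟨y, hy, rfl⟩, rfl⟩
    · exact hX.1 _ ⟨x, hx, rfl⟩
    · simp only [h_inv_inv]
      exact nle_trans (hk.1 _ ⟨y, hy, rfl⟩) hke
  · intro b hb
    refine hX.2 b ?_
    rintro _ ⟨x, hx, rfl⟩
    exact hb _ ⟨x, Or.inl hx, rfl⟩
  · rintro _ ⟨x, hx | ⟨y, hy, rfl⟩, rfl⟩
    · exact nle_trans (hj.1 _ ⟨x, hx, rfl⟩) hjf
    · simp only [h_inv_inv]
      exact hY.1 _ ⟨y, hy, rfl⟩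
  · intro b hb
    refine hY.2 b ?_
    rintro _ ⟨y, hy, rfl⟩
    exact hb _ ⟨y⁻¹, Or.inr ⟨y, hy, rfl⟩, by simp only [h_inv_inv]⟩

end Helpers

/-- **Statement 16.** For a pseudogroup `S` with least element `z`, the following are
equivalent: (1) `S` is 0-simplifying (its only sup-ideals are `{z}` and `S`);
(2) `⪯` is universal on non-zero idempotents; (3) for any two non-zero idempotents
`e, f` there is `Z ⊆ S` with `e = ⋁_{a∈Z} a⁻¹a` and `f = ⋁_{a∈Z} aa⁻¹`. -/
theorem statement16 {S : Type*} [Pseudogroup S] (z : S) (hz : IsJoin (∅ : Set S) z) :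
    ((∀ I : Set S, IsSupIdeal I → I = {z} ∨ I = Set.univ) ↔
      (∀ e f : S, IsIdem e → e ≠ z → IsIdem f → f ≠ z → PencilLE e f)) ∧
    ((∀ I : Set S, IsSupIdeal I → I = {z} ∨ I = Set.univ) ↔
      (∀ e f : S, IsIdem e → e ≠ z → IsIdem f → f ≠ z →
        ∃ Z : Set S, IsJoin ((fun a => a⁻¹ * a) '' Z) e ∧
          IsJoin ((fun a => a * a⁻¹) '' Z) f)) := by
  refine ⟨⟨?_, ?_⟩, ⟨?_, ?_⟩⟩
  · intro H e f he _ hf hfz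
    exact pencil_of_simplifying z H e f he hf hfz
  · exact simplifying_of_pencil z hz
  · intro H e f he hez hf hfz
    exact join_of_pencils (pencil_of_simplifying z H e f he hf hfz)
      (pencil_of_simplifying z H f e hf he hez)
  · intro H
    refine simplifying_of_pencil z hz ?_
    intro e f he hez hf hfz
    obtain ⟨Z, h1, h2⟩ := H e f he hez hf hfz
    exact ⟨Z, h1, f, h2, nle_refl f⟩

end PseudogroupMorita
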